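/- The semi-discrete discontinuous Galerkin / Hermite scheme is stable in the weighted L² norm: for all t ≥ 0, Σ_{n=0}^{N_H−1} α(t) ∫₀ᴸ C_{n,h}(t,x)² dx ≤ e^{t/(2γ)} Σ_{n=0}^{N_H−1} α(0) ∫₀ᴸ C_{n,h}(0,x)² dx. -/

import Mathlib

open MeasureTheory Real

/-- Reindexing of the ladder operator `√(n+1) v_{n+1} + √n v_{n-1}` tested against `u`. -/
lemma sum_ladder_mul (N : ℕ) (v u : ℤ → ℝ) (hv : v N = 0) :
    ∑ n ∈ Finset.range N, (√(((n : ℤ) : ℝ) + 1) * v ((n : ℤ) + 1)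
        + √((n : ℤ) : ℝ) * v ((n : ℤ) - 1)) * u n
      = ∑ n ∈ Finset.range N, √(n : ℝ) * (v n * u ((n : ℤ) - 1) + v ((n : ℤ) - 1) * u n) := by
  have key : ∀ M : ℕ, ∑ n ∈ Finset.range M, (√(((n : ℤ) : ℝ) + 1) * v ((n : ℤ) + 1)
        + √((n : ℤ) : ℝ) * v ((n : ℤ) - 1)) * u n
      = ∑ n ∈ Finset.range M, √(n : ℝ) * (v n * u ((n : ℤ) - 1) + v ((n : ℤ) - 1) * u n)
        + √(M : ℝ) * (v M * u ((M : ℤ) - 1)) := by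
    intro M
    induction M with
    | zero => simp
    | succ M ih =>
      rw [Finset.sum_range_succ, Finset.sum_range_succ, ih]
      push_cast
      rw [add_sub_cancel_right]
      ring
  rw [key, hv]
  ring

/-- The quadratic form of the scaling term is a sum of squares of the ladder operator. -/
lemma sum_sq_ladder_add (N : ℕ) (v : ℤ → ℝ) :
    ∑ n ∈ Finset.range N, (√(((n : ℤ) : ℝ) + 1) * v ((n : ℤ) + 1)
        + √((n : ℤ) : ℝ) * v ((n : ℤ) - 1)) ^ 2 + N * v ((N : ℤ) - 1) ^ 2
      = ∑ n ∈ Finset.range N, ((2 * (n : ℝ) + 1) * v n ^ 2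
          + 2 * √(((n : ℝ) - 1) * n) * v ((n : ℤ) - 2) * v n)
        + N * v N ^ 2 + 2 * √(((N : ℝ) - 1) * N) * v N * v ((N : ℤ) - 2) := by
  induction N with
  | zero => simp
  | succ N ih =>
    rw [Finset.sum_range_succ, Finset.sum_range_succ]
    push_cast
    have h1 : (N : ℤ) + 1 - 2 = N - 1 := by ring
    rw [add_sub_cancel_right, add_sub_cancel_right, h1, Real.sqrt_mul (Nat.cast_nonneg N)]
    have h2 := Real.sq_sqrt (Nat.cast_nonneg (α := ℝ) N)
    have h3 := Real.sq_sqrt (show (0 : ℝ) ≤ (N : ℝ) + 1 by positivity)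
    linear_combination ih + v ((N : ℤ) + 1) ^ 2 * h3 + v ((N : ℤ) - 1) ^ 2 * h2

/-- The scaling term absorbs the electric field up to a growth rate `1 / (2γ)`. -/
lemma sum_scaling_field_le (N : ℕ) (v : ℤ → ℝ) (hv : v N = 0) {γ a e E : ℝ}
    (hγ : 0 < γ) (hE : |E| ≤ e) :
    ∑ n ∈ Finset.range N, (-(γ / 2 * e ^ 2 * a ^ 2) * ((2 * (n : ℝ) + 1) * v n ^ 2
          + 2 * √(((n : ℝ) - 1) * n) * v ((n : ℤ) - 2) * v n)
        + 2 * (a * √(n : ℝ)) * (E * (v ((n : ℤ) - 1) * v n)))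
      ≤ ∑ n ∈ Finset.range N, 1 / (2 * γ) * v n ^ 2 := by
  have hsq := sum_sq_ladder_add N v
  have hlad := sum_ladder_mul N v v hv
  rw [hv] at hsq
  set w : ℕ → ℝ := fun n => √(((n : ℤ) : ℝ) + 1) * v ((n : ℤ) + 1)
        + √((n : ℤ) : ℝ) * v ((n : ℤ) - 1) with hw
  have hE2 : E ^ 2 ≤ e ^ 2 := sq_le_sq.2 (hE.trans (le_abs_self e))
  have hpt : ∀ n ∈ Finset.range N, a * E * (w n * v n)
      ≤ γ / 2 * e ^ 2 * a ^ 2 * w n ^ 2 + 1 / (2 * γ) * v n ^ 2 := by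
    intro n _
    have h1 : 0 ≤ γ / 2 * a ^ 2 * w n ^ 2 * (e ^ 2 - E ^ 2) :=
      mul_nonneg (by positivity) (by linarith)
    have h2 : 0 ≤ 1 / (2 * γ) * (γ * a * E * w n - v n) ^ 2 := by positivity
    have h3 : 1 / (2 * γ) * (γ * a * E * w n - v n) ^ 2
        = γ / 2 * a ^ 2 * w n ^ 2 * E ^ 2 - a * E * (w n * v n) + 1 / (2 * γ) * v n ^ 2 := by
      field_simp
      ring
    linarith
  have hsum := Finset.sum_le_sum hpt
  rw [← Finset.mul_sum, Finset.sum_add_distrib, ← Finset.mul_sum] at hsum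
  have hfield : a * E * ∑ n ∈ Finset.range N, w n * v n
      = ∑ n ∈ Finset.range N, 2 * (a * √(n : ℝ)) * (E * (v ((n : ℤ) - 1) * v n)) := by
    rw [hlad, Finset.mul_sum]
    exact Finset.sum_congr rfl fun n _ => by ring
  rw [Finset.sum_add_distrib, ← Finset.mul_sum, ← hfield]
  have hN : 0 ≤ γ / 2 * e ^ 2 * a ^ 2 * (N * v ((N : ℤ) - 1) ^ 2) := by positivity
  linear_combination hsum + hN + γ / 2 * e ^ 2 * a ^ 2 * hsq

/-- At each mesh node the numerical flux is dissipative. -/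
lemma flux_node_nonneg (N : ℕ) (vm vp d : ℤ → ℝ) (hm : vm N = 0) (hp : vp N = 0)
    (hd : ∀ n, 0 ≤ d n) (a : ℝ) :
    0 ≤ ∑ n ∈ Finset.range N, (-(a * (√(n : ℝ) * (vm n * vm ((n : ℤ) - 1))))
        + a * (√(n : ℝ) * (vp n * vp ((n : ℤ) - 1)))
        + 1 / 2 * (a * (√(((n : ℤ) : ℝ) + 1) * vm ((n : ℤ) + 1) + √((n : ℤ) : ℝ) * vm ((n : ℤ) - 1))
          + a * (√(((n : ℤ) : ℝ) + 1) * vp ((n : ℤ) + 1) + √((n : ℤ) : ℝ) * vp ((n : ℤ) - 1))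
          - d n * (vp n - vm n)) * (vm n - vp n)) := by
  have hlad := sum_ladder_mul N (vm + vp) (vm - vp) (by simp [hm, hp])
  have hdiss : 0 ≤ ∑ n ∈ Finset.range N, 1 / 2 * (d n * (vp n - vm n) ^ 2) :=
    Finset.sum_nonneg fun n _ => by have := hd n; positivity
  refine hdiss.trans_eq ?_
  rw [← sub_eq_zero, ← Finset.sum_sub_distrib] at hlad ⊢
  rw [← neg_eq_zero, ← mul_zero (a / 2), ← hlad, ← Finset.sum_neg_distrib, Finset.mul_sum]
  refine Finset.sum_congr rfl fun n _ => ?_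
  simp only [Pi.add_apply, Pi.sub_apply, Int.cast_natCast]
  ring

/-- Shifting a sum over the cells of a periodic mesh by one cell. -/
lemma sum_Icc_periodic_shift (N : ℕ) (F : ℕ → ℝ) :
    ∑ j ∈ Finset.Icc 1 N, F (if j = N then 1 else j + 1) = ∑ j ∈ Finset.Icc 1 N, F j := by
  refine Finset.sum_nbij' (fun j => if j = N then 1 else j + 1)
    (fun j => if j = 1 then N else j - 1) ?_ ?_ ?_ ?_ (fun _ _ => rfl) <;>
  · intro j hj
    simp only [Finset.mem_Icc] at hj ⊢
    split_ifs <;> omega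

/-- Energy identity: if `P` is a differentiable curve of polynomials of bounded degree, the
derivative of `∫ P²` is twice the derivative of `∫ P φ` with `φ` frozen at `P t`. -/
lemma hasDerivAt_integral_eval_sq {k : ℕ} {P : ℝ → Polynomial ℝ} (hdeg : ∀ τ, (P τ).natDegree ≤ k)
    (hP : ∀ x, Differentiable ℝ fun τ => (P τ).eval x) {a b t D : ℝ}
    (hD : HasDerivAt (fun τ => ∫ x in a..b, (P τ).eval x * (P t).eval x) D t) :
    HasDerivAt (fun τ => ∫ x in a..b, (P τ).eval x ^ 2) (2 * D) t := by
  set s := Finset.range (k + 1)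
  set ℓ : ℕ → Polynomial ℝ := Lagrange.basis s (fun i : ℕ => (i : ℝ))
  set c : ℕ → ℝ → ℝ := fun i τ => (P τ).eval (i : ℝ) with hc
  set M : ℕ → ℕ → ℝ := fun i l => ∫ x in a..b, (ℓ i).eval x * (ℓ l).eval x with hM
  have hrep : ∀ τ x, (P τ).eval x = ∑ i ∈ s, c i τ * (ℓ i).eval x := by
    intro τ x
    have hlt : (P τ).degree < (s.card : ℕ) := by
      refine lt_of_le_of_lt Polynomial.degree_le_natDegree ?_
      simp only [s, Finset.card_range]
      exact_mod_cast Nat.lt_succ_of_le (hdeg τ)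
    have h := Lagrange.eq_interpolate (s := s) (v := fun i : ℕ => (i : ℝ))
      (Nat.cast_injective.injOn) hlt
    conv_lhs => rw [h, Lagrange.interpolate_apply]
    simp [Polynomial.eval_finsetSum, hc, ℓ]
  have hint : ∀ τ σ, ∫ x in a..b, (P τ).eval x * (P σ).eval x
      = ∑ i ∈ s, ∑ l ∈ s, c i τ * c l σ * M i l := by
    intro τ σ
    have hcont : ∀ i l, IntervalIntegrable
        (fun x => c i τ * c l σ * ((ℓ i).eval x * (ℓ l).eval x)) volume a b := fun i l =>
      (continuous_const.mul ((ℓ i).continuous.mul (ℓ l).continuous)).intervalIntegrable _ _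
    calc ∫ x in a..b, (P τ).eval x * (P σ).eval x
        = ∫ x in a..b, ∑ i ∈ s, ∑ l ∈ s, c i τ * c l σ * ((ℓ i).eval x * (ℓ l).eval x) := by
          refine intervalIntegral.integral_congr fun x _ => ?_
          simp only [hrep, Finset.sum_mul_sum]
          exact Finset.sum_congr rfl fun i _ => Finset.sum_congr rfl fun l _ => by ring
      _ = _ := by
          rw [intervalIntegral.integral_finsetSum fun i _ =>
            Continuous.intervalIntegrable (by fun_prop) _ _]
          refine Finset.sum_congr rfl fun i _ => ?_
          rw [intervalIntegral.integral_finsetSum fun l _ => hcont i l]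
          simp only [intervalIntegral.integral_const_mul, hM]
  have hMsymm : ∀ i l, M i l = M l i := fun i l => by simp only [hM, mul_comm]
  have hcd : ∀ i, HasDerivAt (c i) (deriv (c i) t) t := fun i => (hP i t).hasDerivAt
  have hD' : HasDerivAt (fun τ => ∫ x in a..b, (P τ).eval x * (P t).eval x)
      (∑ i ∈ s, ∑ l ∈ s, deriv (c i) t * c l t * M i l) t := by
    simp only [hint]
    exact HasDerivAt.fun_sum fun i _ => HasDerivAt.fun_sum fun l _ =>
      ((hcd i).mul_const _).mul_const _
  have hsq : HasDerivAt (fun τ => ∫ x in a..b, (P τ).eval x ^ 2)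
      (∑ i ∈ s, ∑ l ∈ s, (deriv (c i) t * c l t + c i t * deriv (c l) t) * M i l) t := by
    simp only [pow_two, hint]
    exact HasDerivAt.fun_sum fun i _ => HasDerivAt.fun_sum fun l _ =>
      ((hcd i).mul (hcd l)).mul_const _
  convert hsq using 1
  rw [hD.unique hD', two_mul]
  simp only [add_mul, Finset.sum_add_distrib]
  congr 1
  rw [Finset.sum_comm]
  exact Finset.sum_congr rfl fun i _ => Finset.sum_congr rfl fun l _ => by rw [hMsymm]; ring

/-- A bounded function, measurable or not, may be replaced by a bounded measurable one in all
integrals against polynomials: if it is not measurable, all these integrals are zero. -/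
lemma exists_integrable_mul_polynomial {a b e : ℝ} (hab : a ≤ b) {E : ℝ → ℝ}
    (hE : ∀ x ∈ Set.Icc a b, |E x| ≤ e) :
    ∃ E' : ℝ → ℝ, (∀ x ∈ Set.Icc a b, |E' x| ≤ e) ∧ ∀ p : Polynomial ℝ,
      IntervalIntegrable (fun x => E' x * p.eval x) volume a b ∧
      ∫ x in a..b, E x * p.eval x = ∫ x in a..b, E' x * p.eval x := by
  by_cases hmeas : AEStronglyMeasurable E (volume.restrict (Set.Ioc a b))
  · refine ⟨E, hE, fun p => ⟨?_, rfl⟩⟩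
    have hp : IntegrableOn (fun x => p.eval x) (Set.Ioc a b) volume :=
      (intervalIntegrable_iff_integrableOn_Ioc_of_le hab).1 (p.continuous.intervalIntegrable a b)
    rw [intervalIntegrable_iff_integrableOn_Ioc_of_le hab]
    refine Integrable.bdd_mul (c := e) hp hmeas ?_
    filter_upwards [ae_restrict_mem measurableSet_Ioc] with x hx
    exact hE x (Set.Ioc_subset_Icc_self hx)
  · refine ⟨0, fun x hx => ?_, fun p => ⟨by simp, ?_⟩⟩
    · simpa using (abs_nonneg _).trans (hE x hx)
    · by_cases hp : p = 0
      · simp [hp]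
      simp only [Pi.zero_apply, zero_mul, intervalIntegral.integral_zero]
      refine intervalIntegral.integral_undef fun hint => hmeas ?_
      rw [intervalIntegrable_iff_integrableOn_Ioc_of_le hab] at hint
      have hinv : AEStronglyMeasurable (fun x => (p.eval x)⁻¹) (volume.restrict (Set.Ioc a b)) :=
        p.continuous.measurable.inv.aestronglyMeasurable
      refine (hint.aestronglyMeasurable.mul hinv).congr ?_
      refine ae_restrict_of_ae ?_
      have hroots : ∀ᵐ x ∂(volume : Measure ℝ), ¬ p.IsRoot x := by
        rw [ae_iff]
        simpa using (Polynomial.finite_setOfPred_isRoot hp).measure_zero volume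
      filter_upwards [hroots] with x hx
      exact mul_inv_cancel_right₀ hx (E x)

/-- Scaling and field terms of the energy balance on a single cell. -/
lemma cell_scaling_field_le (N : ℕ) (p : ℤ → Polynomial ℝ) (hp : p N = 0) {a b γ A e : ℝ}
    (hab : a ≤ b) (hγ : 0 < γ) {E : ℝ → ℝ} (hE : ∀ x ∈ Set.Icc a b, |E x| ≤ e) :
    ∑ n ∈ Finset.range N, (-(γ / 2 * e ^ 2 * A ^ 2) * ((∫ x in a..b, (p n).eval x ^ 2)
        + 2 * ∫ x in a..b, (((n : ℤ) : ℝ) * (p n).eval x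
          + √((((n : ℤ) : ℝ) - 1) * ((n : ℤ) : ℝ)) * (p ((n : ℤ) - 2)).eval x) * (p n).eval x)
        + 2 * (A * √((n : ℤ) : ℝ) * ∫ x in a..b, E x * (p ((n : ℤ) - 1)).eval x * (p n).eval x))
      ≤ 1 / (2 * γ) * ∑ n ∈ Finset.range N, ∫ x in a..b, (p n).eval x ^ 2 := by
  obtain ⟨E', hE', hint⟩ := exists_integrable_mul_polynomial hab hE
  set m : ℝ := γ / 2 * e ^ 2 * A ^ 2
  have hsq : ∀ n : ℕ, IntervalIntegrable (fun x => (p n).eval x ^ 2) volume a b := fun n =>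
    ((p n).continuous.pow 2).intervalIntegrable _ _
  have hscale : ∀ n : ℕ, IntervalIntegrable (fun x => (((n : ℤ) : ℝ) * (p n).eval x
      + √((((n : ℤ) : ℝ) - 1) * ((n : ℤ) : ℝ)) * (p ((n : ℤ) - 2)).eval x) * (p n).eval x)
      volume a b := fun n =>
    Continuous.intervalIntegrable (by fun_prop) _ _
  have hfield : ∀ n : ℕ, IntervalIntegrable
      (fun x => E' x * (p ((n : ℤ) - 1) * p n).eval x) volume a b := fun n => (hint _).1
  have hterm : ∀ n : ℕ, IntervalIntegrable (fun x => -m * ((p n).eval x ^ 2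
      + 2 * ((((n : ℤ) : ℝ) * (p n).eval x
        + √((((n : ℤ) : ℝ) - 1) * ((n : ℤ) : ℝ)) * (p ((n : ℤ) - 2)).eval x) * (p n).eval x))
      + 2 * (A * √((n : ℤ) : ℝ) * (E' x * (p ((n : ℤ) - 1) * p n).eval x))) volume a b := fun n =>
    (((hsq n).add ((hscale n).const_mul _)).const_mul _).add (((hfield n).const_mul _).const_mul _)
  calc _ = ∑ n ∈ Finset.range N, ∫ x in a..b, (-m * ((p n).eval x ^ 2
      + 2 * ((((n : ℤ) : ℝ) * (p n).eval x
        + √((((n : ℤ) : ℝ) - 1) * ((n : ℤ) : ℝ)) * (p ((n : ℤ) - 2)).eval x) * (p n).eval x))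
      + 2 * (A * √((n : ℤ) : ℝ) * (E' x * (p ((n : ℤ) - 1) * p n).eval x))) := by
        refine Finset.sum_congr rfl fun n _ => ?_
        rw [intervalIntegral.integral_add (((hsq n).add ((hscale n).const_mul _)).const_mul _)
            (((hfield n).const_mul _).const_mul _), intervalIntegral.integral_const_mul,
          intervalIntegral.integral_add (hsq n) ((hscale n).const_mul _),
          intervalIntegral.integral_const_mul, intervalIntegral.integral_const_mul,
          intervalIntegral.integral_const_mul, ← (hint _).2]
        simp only [Polynomial.eval_mul, mul_assoc]
    _ = ∫ x in a..b, ∑ n ∈ Finset.range N, (-m * ((p n).eval x ^ 2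
      + 2 * ((((n : ℤ) : ℝ) * (p n).eval x
        + √((((n : ℤ) : ℝ) - 1) * ((n : ℤ) : ℝ)) * (p ((n : ℤ) - 2)).eval x) * (p n).eval x))
      + 2 * (A * √((n : ℤ) : ℝ) * (E' x * (p ((n : ℤ) - 1) * p n).eval x))) :=
        (intervalIntegral.integral_finsetSum fun n _ => hterm n).symm
    _ ≤ ∫ x in a..b, ∑ n ∈ Finset.range N, 1 / (2 * γ) * (p n).eval x ^ 2 := by
        refine intervalIntegral.integral_mono_on hab
          (by simpa only [Finset.sum_fn] using
            IntervalIntegrable.sum (Finset.range N) fun n _ => hterm n)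
          (Continuous.intervalIntegrable (by fun_prop) _ _) fun x hx => ?_
        refine le_trans (le_of_eq ?_) (sum_scaling_field_le N (fun n => (p n).eval x)
          (by simp [hp]) (a := A) hγ (hE' x hx))
        refine Finset.sum_congr rfl fun n _ => ?_
        simp only [Polynomial.eval_mul, Int.cast_natCast]
        ring
    _ = _ := by
        rw [intervalIntegral.integral_finsetSum fun n _ => (hsq n).const_mul _, Finset.mul_sum]
        simp only [intervalIntegral.integral_const_mul]

/-- Integration by parts for the transport term on a single cell. -/
lemma cell_transport_eq (N : ℕ) (p : ℤ → Polynomial ℝ) (hp : p N = 0) (a b A : ℝ) :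
    ∑ n ∈ Finset.range N, ∫ x in a..b, A * (√(((n : ℤ) : ℝ) + 1) * (p ((n : ℤ) + 1)).eval x
          + √((n : ℤ) : ℝ) * (p ((n : ℤ) - 1)).eval x) * (p n).derivative.eval x
      = ∑ n ∈ Finset.range N, (A * (√(n : ℝ) * ((p n).eval b * (p ((n : ℤ) - 1)).eval b))
          - A * (√(n : ℝ) * ((p n).eval a * (p ((n : ℤ) - 1)).eval a))) := by
  rw [← intervalIntegral.integral_finsetSum fun n _ =>
    Continuous.intervalIntegrable (by fun_prop) _ _, Finset.sum_sub_distrib]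
  refine intervalIntegral.integral_eq_sub_of_hasDerivAt
    (f := fun x => ∑ n ∈ Finset.range N,
      A * (√(n : ℝ) * ((p n).eval x * (p ((n : ℤ) - 1)).eval x))) (fun x _ => ?_)
    (Continuous.intervalIntegrable (by fun_prop) _ _)
  have hder := HasDerivAt.fun_sum (u := Finset.range N) fun n _ =>
    ((((p n).hasDerivAt x).mul ((p ((n : ℤ) - 1)).hasDerivAt x)).const_mul (√(n : ℝ))).const_mul A
  refine hder.congr_deriv ?_
  have hlad := sum_ladder_mul N (fun n => (p n).eval x) (fun n => (p n).derivative.eval x)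
    (by simp [hp])
  simp only [mul_assoc, ← Finset.mul_sum, hlad]
  exact congrArg _ (Finset.sum_congr rfl fun n _ => by ring)

/-- Differential form of Grönwall's inequality on the half-line. -/
lemma le_exp_mul_of_hasDerivAt_le {W W' : ℝ → ℝ} {c : ℝ}
    (hW : ∀ t, 0 ≤ t → HasDerivAt W (W' t) t) (hle : ∀ t, 0 ≤ t → W' t ≤ c * W t) :
    ∀ t, 0 ≤ t → W t ≤ Real.exp (c * t) * W 0 := by
  have hderiv : ∀ t, 0 ≤ t → HasDerivAt (fun s => Real.exp (-(c * s)) * W s)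
      (Real.exp (-(c * t)) * (W' t - c * W t)) t := by
    intro t ht
    refine ((((hasDerivAt_id' t).const_mul c).fun_neg.exp).mul (hW t ht)).congr_deriv ?_
    ring
  have hanti : AntitoneOn (fun s => Real.exp (-(c * s)) * W s) (Set.Ici 0) := by
    refine antitoneOn_of_hasDerivWithinAt_nonpos (convex_Ici 0)
      (fun t ht => (hderiv t ht).continuousAt.continuousWithinAt)
      (fun t ht => (hderiv t (interior_subset ht)).hasDerivWithinAt) fun t ht => ?_
    have := hle t (interior_subset ht)
    exact mul_nonpos_of_nonneg_of_nonpos (Real.exp_pos _).le (by linarith)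
  intro t ht
  have h := hanti (Set.self_mem_Ici) ht ht
  simp only [mul_zero, neg_zero, Real.exp_zero, one_mul, Real.exp_neg] at h
  rwa [inv_mul_le_iff₀ (Real.exp_pos _)] at h

/-- Weighted L² stability for the semi-discrete DG/Hermite scheme. -/
theorem dg_hermite_weighted_L2_stability
    (N_H k N_x : ℕ) (hNH : 3 ≤ N_H) (hNx : 1 ≤ N_x)
    (L α₀ γ : ℝ) (hL : 0 < L) (hα₀ : 0 < α₀) (hγ : 0 < γ)
    -- the mesh 0 = x_{1/2} < x_{3/2} < ⋯ < x_{N_x+1/2} = L; `X j` is the node x_{j+1/2}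
    (X : ℕ → ℝ) (hX0 : X 0 = 0) (hXL : X N_x = L)
    (hXmono : ∀ j, j < N_x → X j < X (j + 1))
    -- the piecewise-polynomial coefficients: `C n t j` is the polynomial of degree ≤ k
    -- representing C_{n,h}(t,·) on the cell I_j = [X (j-1), X j], j = 1, …, N_x
    (C : ℤ → ℝ → ℕ → Polynomial ℝ)
    (hdeg : ∀ (n : ℤ) (t : ℝ) (j : ℕ), (C n t j).natDegree ≤ k)
    (hCneg : ∀ n : ℤ, n < 0 → ∀ (t : ℝ) (j : ℕ), C n t j = 0)
    (hCbig : ∀ n : ℤ, (N_H : ℤ) ≤ n → ∀ (t : ℝ) (j : ℕ), C n t j = 0)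
    (hCdiff : ∀ (n : ℤ) (j : ℕ) (x : ℝ), Differentiable ℝ (fun t => (C n t j).eval x))
    -- the electric field, bounded on [0,L], with continuous sup norm `Einf`
    (Eh : ℝ → ℝ → ℝ) (Einf : ℝ → ℝ)
    (hEinf : ∀ t, Einf t = sSup {y | ∃ x ∈ Set.Icc (0:ℝ) L, y = |Eh t x|})
    (hEbdd : ∀ t, BddAbove {y | ∃ x ∈ Set.Icc (0:ℝ) L, y = |Eh t x|})
    (hEcont : Continuous Einf)
    -- the scaling function α and its derivative α' = -(γ/2) ‖E_h‖_∞² α³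
    (α αd : ℝ → ℝ)
    (hα : ∀ t, α t = α₀ / Real.sqrt (1 + γ * ∫ s in (0:ℝ)..t, (Einf s) ^ 2))
    (hαd : ∀ t, αd t = -(γ / 2) * (Einf t) ^ 2 * (α t) ^ 3)
    (hαderiv : ∀ t, 0 ≤ t → HasDerivAt α (αd t) t)
    -- traces: `Cm n t j` (resp. `Cp n t j`) is the left (resp. right) one-sided value
    -- of C_{n,h}(t,·) at the node x_{j-1/2}, with periodic identification
    (Cm Cp : ℤ → ℝ → ℕ → ℝ)
    (hCm : ∀ (n : ℤ) (t : ℝ) (j : ℕ),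
      Cm n t j = (C n t (if j = 1 then N_x else j - 1)).eval (if j = 1 then X N_x else X (j - 1)))
    (hCp : ∀ (n : ℤ) (t : ℝ) (j : ℕ), Cp n t j = (C n t j).eval (X (j - 1)))
    -- the numerical viscosity δₙ : δ₀ = 0 and δₙ = √(N_H)/α for 1 ≤ n ≤ N_H - 1
    (δ : ℤ → ℝ → ℝ)
    (hδ : ∀ (n : ℤ) (t : ℝ), δ n t = if n = 0 then 0 else Real.sqrt (N_H : ℝ) / α t)
    -- the numerical flux ĝₙ = (1/2)(gₙ⁻ + gₙ⁺ - δₙ (Cₙ⁺ - Cₙ⁻)) at the node x_{j-1/2}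
    (ghat : ℤ → ℝ → ℕ → ℝ)
    (hghat : ∀ (n : ℤ) (t : ℝ) (j : ℕ),
      ghat n t j = (1 / 2) *
        ((1 / α t) * (Real.sqrt ((n : ℝ) + 1) * Cm (n + 1) t j + Real.sqrt (n : ℝ) * Cm (n - 1) t j)
          + (1 / α t) * (Real.sqrt ((n : ℝ) + 1) * Cp (n + 1) t j + Real.sqrt (n : ℝ) * Cp (n - 1) t j)
          - δ n t * (Cp n t j - Cm n t j)))
    -- the semi-discrete DG scheme: for every cell j and test polynomial φ of degree ≤ k
    (hDG : ∀ n : ℤ, 0 ≤ n → n < (N_H : ℤ) → ∀ j ∈ Finset.Icc 1 N_x, ∀ t : ℝ, 0 ≤ t →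
      ∀ φ : Polynomial ℝ, φ.natDegree ≤ k →
      HasDerivAt (fun τ => ∫ x in X (j - 1)..X j, (C n τ j).eval x * φ.eval x)
        ((αd t / α t) * (∫ x in X (j - 1)..X j,
            ((n : ℝ) * (C n t j).eval x
              + Real.sqrt (((n : ℝ) - 1) * (n : ℝ)) * (C (n - 2) t j).eval x) * φ.eval x)
          - (-(∫ x in X (j - 1)..X j,
                (1 / α t) * (Real.sqrt ((n : ℝ) + 1) * (C (n + 1) t j).eval x
                  + Real.sqrt (n : ℝ) * (C (n - 1) t j).eval x)
                  * (Polynomial.derivative φ).eval x)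
              + ghat n t (if j = N_x then 1 else j + 1) * φ.eval (X j)
              - ghat n t j * φ.eval (X (j - 1)))
          + α t * Real.sqrt (n : ℝ) *
            ∫ x in X (j - 1)..X j, Eh t x * (C (n - 1) t j).eval x * φ.eval x) t) :
    ∀ t, 0 ≤ t →
      ∑ n ∈ Finset.range N_H,
          α t * ∑ j ∈ Finset.Icc 1 N_x, ∫ x in X (j - 1)..X j, ((C n t j).eval x) ^ 2
        ≤ Real.exp (t / (2 * γ)) *
          ∑ n ∈ Finset.range N_H,
            α 0 * ∑ j ∈ Finset.Icc 1 N_x, ∫ x in X (j - 1)..X j, ((C n 0 j).eval x) ^ 2 := by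
  have hintE : ∀ t, 0 ≤ t → 0 ≤ ∫ s in (0:ℝ)..t, (Einf s) ^ 2 := fun t ht =>
    intervalIntegral.integral_nonneg ht fun s _ => sq_nonneg _
  have hαpos : ∀ t, 0 ≤ t → 0 < α t := by
    intro t ht
    have := mul_nonneg hγ.le (hintE t ht)
    rw [hα]
    exact div_pos hα₀ (Real.sqrt_pos.2 (by linarith))
  have hmesh : ∀ j ≤ N_x, 0 ≤ X j ∧ X j ≤ L := by
    have hmono : MonotoneOn X (Set.Icc 0 N_x) :=
      monotoneOn_of_le_add_one Set.ordConnected_Icc fun j _ _ hj =>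
        (hXmono j (Nat.lt_of_succ_le hj.2)).le
    intro j hj
    constructor
    · rw [← hX0]
      exact hmono ⟨le_rfl, Nat.zero_le _⟩ ⟨Nat.zero_le _, hj⟩ (Nat.zero_le _)
    · rw [← hXL]
      exact hmono ⟨Nat.zero_le _, hj⟩ ⟨Nat.zero_le _, le_rfl⟩ hj
  have hcell : ∀ j ∈ Finset.Icc 1 N_x, X (j - 1) ≤ X j := by
    intro j hj
    rw [Finset.mem_Icc] at hj
    have := (hXmono (j - 1) (by omega)).le
    rwa [Nat.sub_add_cancel hj.1] at this
  have hEle : ∀ t, ∀ x ∈ Set.Icc (0 : ℝ) L, |Eh t x| ≤ Einf t := by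
    intro t x hx
    rw [hEinf]
    exact le_csSup (hEbdd t) ⟨x, hx, rfl⟩
  have hCN : ∀ t j, C (N_H : ℤ) t j = 0 := fun t j => hCbig _ le_rfl t j
  set T : ℕ → ℕ → ℝ → ℝ := fun n j t =>
    -(∫ x in X (j - 1)..X j,
        (1 / α t) * (√(((n : ℤ) : ℝ) + 1) * (C ((n : ℤ) + 1) t j).eval x
          + √((n : ℤ) : ℝ) * (C ((n : ℤ) - 1) t j).eval x)
          * (Polynomial.derivative (C n t j)).eval x)
      + ghat n t (if j = N_x then 1 else j + 1) * (C n t j).eval (X j)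
      - ghat n t j * (C n t j).eval (X (j - 1)) with hT
  have hTnonneg : ∀ t, 0 ≤ t →
      0 ≤ ∑ j ∈ Finset.Icc 1 N_x, ∑ n ∈ Finset.range N_H, T n j t := by
    intro t ht
    have hα_pos := hαpos t ht
    set f : ℕ → ℝ := fun j => ∑ n ∈ Finset.range N_H,
      (ghat n t j * Cm n t j - (1 / α t) * (√(n : ℝ) * (Cm n t j * Cm ((n : ℤ) - 1) t j))) with hf
    set h : ℕ → ℝ := fun j => ∑ n ∈ Finset.range N_H,
      (ghat n t j * Cp n t j - (1 / α t) * (√(n : ℝ) * (Cp n t j * Cp ((n : ℤ) - 1) t j))) with hh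
    have htrace : ∀ j ∈ Finset.Icc 1 N_x, ∀ n : ℤ,
        Cm n t (if j = N_x then 1 else j + 1) = (C n t j).eval (X j) := by
      intro j hj n
      rw [Finset.mem_Icc] at hj
      rw [hCm]
      by_cases hjN : j = N_x
      · simp [hjN]
      · simp [hjN, show j ≠ 0 by omega]
    have hTj : ∀ j ∈ Finset.Icc 1 N_x, ∑ n ∈ Finset.range N_H, T n j t
        = f (if j = N_x then 1 else j + 1) - h j := by
      intro j hj
      simp only [hT, hf, hh, htrace j hj, hCp]
      have := cell_transport_eq N_H (fun n => C n t j) (hCN t j) (X (j - 1)) (X j) (1 / α t)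
      simp only [Finset.sum_add_distrib, Finset.sum_sub_distrib, Finset.sum_neg_distrib] at this ⊢
      rw [this]
      ring
    rw [Finset.sum_congr rfl hTj, Finset.sum_sub_distrib, sum_Icc_periodic_shift,
      ← Finset.sum_sub_distrib]
    refine Finset.sum_nonneg fun j _ => ?_
    refine (flux_node_nonneg N_H (fun n => Cm n t j) (fun n => Cp n t j) (fun n => δ n t)
      (by simp [hCm, hCN]) (by simp [hCp, hCN]) (fun n => ?_) (1 / α t)).trans_eq ?_
    · rw [hδ]
      split_ifs
      · exact le_rfl
      · positivity
    · simp only [hf, hh]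
      rw [← Finset.sum_sub_distrib]
      refine Finset.sum_congr rfl fun n _ => ?_
      rw [hghat]
      ring
  set D : ℕ → ℕ → ℝ → ℝ := fun n j t =>
    (αd t / α t) * (∫ x in X (j - 1)..X j,
        (((n : ℤ) : ℝ) * (C n t j).eval x
          + √((((n : ℤ) : ℝ) - 1) * ((n : ℤ) : ℝ)) * (C ((n : ℤ) - 2) t j).eval x)
          * (C n t j).eval x)
      - T n j t
      + α t * √((n : ℤ) : ℝ) *
        ∫ x in X (j - 1)..X j, Eh t x * (C ((n : ℤ) - 1) t j).eval x * (C n t j).eval x with hD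
  have henergy : ∀ n ∈ Finset.range N_H, ∀ j ∈ Finset.Icc 1 N_x, ∀ t, 0 ≤ t →
      HasDerivAt (fun τ => ∫ x in X (j - 1)..X j, (C n τ j).eval x ^ 2) (2 * D n j t) t := by
    intro n hn j hj t ht
    exact hasDerivAt_integral_eval_sq (fun τ => hdeg n τ j) (hCdiff n j)
      (hDG n (Int.natCast_nonneg n) (by exact_mod_cast Finset.mem_range.1 hn) j hj t ht
        (C n t j) (hdeg n t j))
  have hderiv : ∀ t, 0 ≤ t → HasDerivAt
      (fun τ => ∑ n ∈ Finset.range N_H,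
        α τ * ∑ j ∈ Finset.Icc 1 N_x, ∫ x in X (j - 1)..X j, ((C n τ j).eval x) ^ 2)
      (∑ n ∈ Finset.range N_H,
        (αd t * (∑ j ∈ Finset.Icc 1 N_x, ∫ x in X (j - 1)..X j, ((C n t j).eval x) ^ 2)
          + α t * ∑ j ∈ Finset.Icc 1 N_x, 2 * D n j t)) t := fun t ht =>
    HasDerivAt.fun_sum fun n hn => (hαderiv t ht).mul
      (HasDerivAt.fun_sum fun j hj => henergy n hn j hj t ht)
  have hgrowth := le_exp_mul_of_hasDerivAt_le (c := 1 / (2 * γ)) hderiv fun t ht => ?_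
  · intro t ht
    have := hgrowth t ht
    rwa [one_div_mul_eq_div] at this
  have hα_pos := hαpos t ht
  have hratio : αd t = α t * -(γ / 2 * Einf t ^ 2 * α t ^ 2) := by
    rw [hαd]
    ring
  have hlocal : ∀ j ∈ Finset.Icc 1 N_x, ∑ n ∈ Finset.range N_H,
        (αd t * (∫ x in X (j - 1)..X j, ((C n t j).eval x) ^ 2) + α t * (2 * D n j t))
      ≤ α t * (1 / (2 * γ) * ∑ n ∈ Finset.range N_H, ∫ x in X (j - 1)..X j, (C n t j).eval x ^ 2)
        - 2 * α t * ∑ n ∈ Finset.range N_H, T n j t := by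
    intro j hj
    have hj' := Finset.mem_Icc.1 hj
    have hcellj := mul_le_mul_of_nonneg_left (cell_scaling_field_le N_H (fun n => C n t j)
      (hCN t j) (A := α t) (hcell j hj) hγ fun x hx => hEle t x
        ⟨(hmesh (j - 1) (by omega)).1.trans hx.1, hx.2.trans (hmesh j hj'.2).2⟩) hα_pos.le
    refine le_trans (le_of_eq ?_) (sub_le_sub_right hcellj _)
    rw [Finset.mul_sum, Finset.mul_sum, ← Finset.sum_sub_distrib]
    refine Finset.sum_congr rfl fun n _ => ?_
    simp only [hD]
    rw [hratio, mul_div_cancel_left₀ _ hα_pos.ne']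
    ring
  have hsum := Finset.sum_le_sum hlocal
  rw [Finset.sum_sub_distrib, ← Finset.mul_sum, ← Finset.mul_sum, ← Finset.mul_sum,
    Finset.sum_comm, Finset.sum_comm (s := Finset.Icc 1 N_x) (t := Finset.range N_H)
      (f := fun j n => ∫ x in X (j - 1)..X j, (C n t j).eval x ^ 2)] at hsum
  have hdiss := mul_nonneg (mul_nonneg zero_le_two hα_pos.le) (hTnonneg t ht)
  simp only [Finset.sum_add_distrib, ← Finset.mul_sum] at hsum ⊢
  linear_combination hsum + hdiss
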